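/- If ⋯ → P_n → P_{n−1} → ⋯ → P_1 → P_0 → S₂ → 0 is a minimal projective resolution of the simple A-module S₂, then dim_k P_n ≥ 2^{n/2} for all n ≥ 0. In particular, the dimensions of the terms of every projective resolution of S₂ grow at least exponentially. -/

import Mathlib

/-!
We formalize statements about the algebra `A = kQ/J²`, where `Q` is the quiver
`1 ⇄ 2 ⇄ 3` and `J` is the arrow ideal of the path algebra `kQ`.
The algebra `A` is presented by generators and relations as a quotient of the
free algebra on three vertex idempotents and four arrows.
Right `A`-modules are treated as left modules over `Aᵐᵒᵖ`.
-/

open CategoryTheory Opposite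

/-- Generators of the path algebra `kQ`: three vertex idempotents `e i`
and four arrows `ar a`, where the arrows of `Q` are
`α : 1 → 2`, `β : 2 → 1`, `γ : 2 → 3`, `δ : 3 → 2`. -/
inductive QGen : Type
  | e : Fin 3 → QGen
  | ar : Fin 4 → QGen

/-- The sources of the four arrows `α, β, γ, δ` (vertices `1,2,3` are `0,1,2 : Fin 3`). -/
def arrowSrc : Fin 4 → Fin 3 := ![0, 1, 1, 2]

/-- The targets of the four arrows `α, β, γ, δ`. -/
def arrowTgt : Fin 4 → Fin 3 := ![1, 0, 2, 1]

/-- The defining relations of `A = kQ/J²`: the `e i` are orthogonal idempotents summing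
to `1`, the arrows are compatible with their sources and targets, and any product of
two arrows vanishes (`J² = 0`). -/
inductive ARel (k : Type) [Field k] : FreeAlgebra k QGen → FreeAlgebra k QGen → Prop
  | idem (i j : Fin 3) :
      ARel k (FreeAlgebra.ι k (QGen.e i) * FreeAlgebra.ι k (QGen.e j))
        (if i = j then FreeAlgebra.ι k (QGen.e i) else 0)
  | sum : ARel k
      (FreeAlgebra.ι k (QGen.e 0) + FreeAlgebra.ι k (QGen.e 1) + FreeAlgebra.ι k (QGen.e 2)) 1
  | src (a : Fin 4) :
      ARel k (FreeAlgebra.ι k (QGen.e (arrowSrc a)) * FreeAlgebra.ι k (QGen.ar a))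
        (FreeAlgebra.ι k (QGen.ar a))
  | tgt (a : Fin 4) :
      ARel k (FreeAlgebra.ι k (QGen.ar a) * FreeAlgebra.ι k (QGen.e (arrowTgt a)))
        (FreeAlgebra.ι k (QGen.ar a))
  | radsq (a b : Fin 4) :
      ARel k (FreeAlgebra.ι k (QGen.ar a) * FreeAlgebra.ι k (QGen.ar b)) 0

/-- The algebra `A = kQ/J²`. -/
abbrev AlgA (k : Type) [Field k] : Type := RingQuot (ARel k)

/-- Right `A`-modules are left modules over `Aop k = Aᵐᵒᵖ`. -/
abbrev Aop (k : Type) [Field k] : Type := (AlgA k)ᵐᵒᵖ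

/-- The algebra homomorphism `A → k` corresponding to the vertex `i`. -/
noncomputable def simpleAlgHom (k : Type) [Field k] (i : Fin 3) : AlgA k →ₐ[k] k :=
  RingQuot.liftAlgHom k
    ⟨FreeAlgebra.lift k (fun g => match g with
        | QGen.e j => if j = i then (1 : k) else 0
        | QGen.ar _ => 0), by
      intro _x _y h
      induction h with
      | idem i j =>
          simp only [map_mul, FreeAlgebra.lift_ι_apply, apply_ite, map_zero]
          split_ifs <;> simp_all
      | sum =>
          simp only [map_add, map_one, FreeAlgebra.lift_ι_apply]
          fin_cases i <;> simp
      | src a => simp [FreeAlgebra.lift_ι_apply]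
      | tgt a => simp [FreeAlgebra.lift_ι_apply]
      | radsq a b => simp [FreeAlgebra.lift_ι_apply]⟩

/-- The ring homomorphism `Aᵐᵒᵖ → k` corresponding to the vertex `i`. -/
noncomputable def simpleRingHom (k : Type) [Field k] (i : Fin 3) : Aop k →+* k :=
  RingHom.fromOpposite (simpleAlgHom k i).toRingHom (fun _ _ => mul_comm _ _)

/-- The simple right `A`-module `S_{i+1}` at the vertex `i` (one-dimensional over `k`,
with `e i` acting as the identity and all arrows acting by zero).
So `SimpleS k 0 = S₁`, `SimpleS k 1 = S₂` and `SimpleS k 2 = S₃`. -/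
def SimpleS (k : Type) [Field k] (_i : Fin 3) : Type := k

instance (k : Type) [Field k] (i : Fin 3) : AddCommGroup (SimpleS k i) :=
  inferInstanceAs (AddCommGroup k)

instance (k : Type) [Field k] (i : Fin 3) : Module k (SimpleS k i) :=
  inferInstanceAs (Module k k)

noncomputable instance (k : Type) [Field k] (i : Fin 3) : Module (Aop k) (SimpleS k i) :=
  Module.compHom (SimpleS k i) (simpleRingHom k i)

/-- The underlying type of `D(A) = Hom_k(A, k)`. -/
abbrev DualA (k : Type) [Field k] : Type := AlgA k →ₗ[k] k

/-- The right `A`-module structure on `D(A)`: `(φ · a) x = φ (a * x)`. -/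
noncomputable instance (k : Type) [Field k] : Module (Aop k) (DualA k) where
  smul a φ := φ.comp (LinearMap.mulLeft k a.unop)
  one_smul φ := by
    show φ.comp (LinearMap.mulLeft k ((1 : Aop k).unop)) = φ
    ext x; simp
  mul_smul a b φ := by
    show φ.comp (LinearMap.mulLeft k ((a * b).unop)) =
      (φ.comp (LinearMap.mulLeft k b.unop)).comp (LinearMap.mulLeft k a.unop)
    ext x; simp [mul_assoc]
  smul_zero a := by
    show (0 : DualA k).comp (LinearMap.mulLeft k a.unop) = 0
    ext x; simp
  smul_add a φ ψ := by
    show (φ + ψ).comp (LinearMap.mulLeft k a.unop) =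
      φ.comp (LinearMap.mulLeft k a.unop) + ψ.comp (LinearMap.mulLeft k a.unop)
    ext x; simp
  add_smul a b φ := by
    show φ.comp (LinearMap.mulLeft k ((a + b).unop)) =
      φ.comp (LinearMap.mulLeft k a.unop) + φ.comp (LinearMap.mulLeft k b.unop)
    ext x; simp [add_mul]
  zero_smul φ := by
    show φ.comp (LinearMap.mulLeft k ((0 : Aop k).unop)) = 0
    ext x; simp

/-- The right `A`-module `M = A ⊕ D(A)`, where `A` carries the right regular
`A`-module structure. -/
abbrev MA (k : Type) [Field k] : Type := AlgA k × DualA k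

/-- `X` belongs to `add M`: `X` is (isomorphic to) a direct summand of `Mⁿ` for some `n`. -/
def InAdd (k : Type) [Field k] (M X : Type) [AddCommGroup M] [Module (Aop k) M]
    [AddCommGroup X] [Module (Aop k) X] : Prop :=
  ∃ (n : ℕ) (ι : X →ₗ[Aop k] (Fin n → M)) (π : (Fin n → M) →ₗ[Aop k] X),
    π.comp ι = LinearMap.id

/-- `Ext^i_A(X, Y)` for right `A`-modules `X` and `Y`, computed in the abelian
category of all right `A`-modules (which has the same `Ext` groups as `mod A`). -/
noncomputable def ExtA (k : Type) [Field k] (X Y : Type) [AddCommGroup X] [Module (Aop k) X]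
    [AddCommGroup Y] [Module (Aop k) Y] (i : ℕ) : Type :=
  ((Ext ℤ (ModuleCat (Aop k)) i).obj (op (ModuleCat.of (Aop k) X))).obj (ModuleCat.of (Aop k) Y)

/-- The data `(P, ε, d)` is a minimal projective resolution
`⋯ → P 1 → P 0 → N → 0` of the right `A`-module `N`: all the `P n` are projective,
the complex is exact, and all the kernels are superfluous submodules (i.e. each
induced map onto a syzygy is a projective cover). -/
def IsMinimalProjRes (k : Type) [Field k] {N : Type} [AddCommGroup N] [Module (Aop k) N]
    (P : ℕ → Type) [∀ n, AddCommGroup (P n)] [∀ n, Module (Aop k) (P n)]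
    (ε : P 0 →ₗ[Aop k] N) (d : ∀ n, P (n + 1) →ₗ[Aop k] P n) : Prop :=
  (∀ n, Module.Projective (Aop k) (P n)) ∧
  Function.Surjective ε ∧
  LinearMap.range (d 0) = LinearMap.ker ε ∧
  (∀ n, LinearMap.range (d (n + 1)) = LinearMap.ker (d n)) ∧
  (∀ K : Submodule (Aop k) (P 0), K ⊔ LinearMap.ker ε = ⊤ → K = ⊤) ∧
  (∀ n, ∀ K : Submodule (Aop k) (P (n + 1)), K ⊔ LinearMap.ker (d n) = ⊤ → K = ⊤)

section AlgebraStructure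

variable {k : Type} [Field k]

variable (k) in
/-- The class of the trivial path at the vertex `i` in `A`. -/
noncomputable def vertexIdem (i : Fin 3) : AlgA k :=
  RingQuot.mkAlgHom k (ARel k) (FreeAlgebra.ι k (QGen.e i))

variable (k) in
/-- The class of the arrow `a` in `A`. -/
noncomputable def arrowElt (a : Fin 4) : AlgA k :=
  RingQuot.mkAlgHom k (ARel k) (FreeAlgebra.ι k (QGen.ar a))

lemma vertexIdem_mul_vertexIdem (i j : Fin 3) :
    vertexIdem k i * vertexIdem k j = if i = j then vertexIdem k i else 0 := by
  have h := RingQuot.mkAlgHom_rel k (ARel.idem (k := k) i j)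
  rw [map_mul, apply_ite (RingQuot.mkAlgHom k (ARel k)), map_zero] at h
  exact h

lemma sum_vertexIdem : ∑ i, vertexIdem k i = 1 := by
  have h := RingQuot.mkAlgHom_rel k (ARel.sum (k := k))
  rw [map_add, map_add, map_one] at h
  rw [Fin.sum_univ_three]
  exact h

lemma vertexIdem_arrowSrc_mul (a : Fin 4) :
    vertexIdem k (arrowSrc a) * arrowElt k a = arrowElt k a := by
  have h := RingQuot.mkAlgHom_rel k (ARel.src (k := k) a)
  rw [map_mul] at h
  exact h

lemma mul_vertexIdem_arrowTgt (a : Fin 4) :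
    arrowElt k a * vertexIdem k (arrowTgt a) = arrowElt k a := by
  have h := RingQuot.mkAlgHom_rel k (ARel.tgt (k := k) a)
  rw [map_mul] at h
  exact h

lemma arrowElt_mul_arrowElt (a b : Fin 4) : arrowElt k a * arrowElt k b = 0 := by
  have h := RingQuot.mkAlgHom_rel k (ARel.radsq (k := k) a b)
  rw [map_mul, map_zero] at h
  exact h

lemma vertexIdem_mul_arrowElt (i : Fin 3) (a : Fin 4) :
    vertexIdem k i * arrowElt k a = if i = arrowSrc a then arrowElt k a else 0 := by
  rw [← vertexIdem_arrowSrc_mul, ← mul_assoc, vertexIdem_mul_vertexIdem]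
  split_ifs with h
  · rw [h]
  · exact zero_mul _

lemma arrowElt_mul_vertexIdem (a : Fin 4) (i : Fin 3) :
    arrowElt k a * vertexIdem k i = if arrowTgt a = i then arrowElt k a else 0 := by
  rw [← mul_vertexIdem_arrowTgt, mul_assoc, vertexIdem_mul_vertexIdem]
  split_ifs <;> simp

lemma simpleAlgHom_vertexIdem (i j : Fin 3) :
    simpleAlgHom k i (vertexIdem k j) = if j = i then 1 else 0 := by
  simp [simpleAlgHom, vertexIdem]

lemma simpleAlgHom_arrowElt (i : Fin 3) (a : Fin 4) :
    simpleAlgHom k i (arrowElt k a) = 0 := by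
  simp [simpleAlgHom, arrowElt]

variable (k) in
/-- The two-dimensional representation of `A` supported on the arrow `a`. -/
noncomputable def arrowRep (a : Fin 4) : AlgA k →ₐ[k] Matrix (Fin 2) (Fin 2) k :=
  RingQuot.liftAlgHom k
    ⟨FreeAlgebra.lift k (fun g => match g with
        | QGen.e j => !![if j = arrowSrc a then 1 else 0, 0; 0, if j = arrowTgt a then 1 else 0]
        | QGen.ar b => !![0, if b = a then 1 else 0; 0, 0]), by
      intro x y h
      induction h with
      | idem i j =>
          by_cases h : i = j
          · subst h
            simp only [map_mul, FreeAlgebra.lift_ι_apply, Matrix.mul_fin_two, if_true]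
            simp
          · simp only [h, map_mul, FreeAlgebra.lift_ι_apply, map_zero, if_false,
              Matrix.mul_fin_two]
            ext p q
            fin_cases p <;> fin_cases q <;> simp <;> grind
      | sum =>
          simp only [map_add, map_one, FreeAlgebra.lift_ι_apply]
          ext p q
          fin_cases a <;> fin_cases p <;> fin_cases q <;> simp [arrowSrc, arrowTgt]
      | src b =>
          simp only [map_mul, FreeAlgebra.lift_ι_apply, Matrix.mul_fin_two]
          by_cases h : b = a <;> simp [h]
      | tgt b =>
          simp only [map_mul, FreeAlgebra.lift_ι_apply, Matrix.mul_fin_two]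
          by_cases h : b = a <;> simp [h]
      | radsq b c =>
          simp only [map_mul, FreeAlgebra.lift_ι_apply, Matrix.mul_fin_two, map_zero]
          ext p q
          fin_cases p <;> fin_cases q <;> simp⟩

variable (k) in
/-- The coefficient of the arrow `a` in an element of `A`. -/
noncomputable def arrowCoeff (a : Fin 4) : AlgA k →ₗ[k] k :=
  Matrix.entryLinearMap k k 0 1 ∘ₗ (arrowRep k a).toLinearMap

lemma arrowCoeff_vertexIdem (a : Fin 4) (i : Fin 3) :
    arrowCoeff k a (vertexIdem k i) = 0 := by
  simp [arrowCoeff, arrowRep, vertexIdem]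

lemma arrowCoeff_arrowElt (a b : Fin 4) :
    arrowCoeff k a (arrowElt k b) = if b = a then 1 else 0 := by
  simp [arrowCoeff, arrowRep, arrowElt]

variable (k) in
lemma span_vertexIdem_arrowElt :
    Submodule.span k (Set.range (vertexIdem k) ∪ Set.range (arrowElt k)) = ⊤ := by
  set S := Submodule.span k (Set.range (vertexIdem k) ∪ Set.range (arrowElt k)) with hS
  have he (i) : vertexIdem k i ∈ S := Submodule.subset_span (Or.inl ⟨i, rfl⟩)
  have ha (a) : arrowElt k a ∈ S := Submodule.subset_span (Or.inr ⟨a, rfl⟩)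
  have hone : (1 : AlgA k) ∈ S := sum_vertexIdem (k := k) ▸ sum_mem fun i _ => he i
  have hmul : ∀ x y, x ∈ S → y ∈ S → x * y ∈ S := by
    intro x y hx hy
    have hle : S * S ≤ S := by
      conv_lhs => rw [hS, Submodule.span_mul_span]
      rw [Submodule.span_le]
      rintro _ ⟨_, ⟨i, rfl⟩ | ⟨a, rfl⟩, _, ⟨j, rfl⟩ | ⟨b, rfl⟩, rfl⟩ <;>
        simp only [SetLike.mem_coe, vertexIdem_mul_vertexIdem, vertexIdem_mul_arrowElt,
          arrowElt_mul_vertexIdem, arrowElt_mul_arrowElt] <;>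
        (try split_ifs) <;> first | exact he _ | exact ha _ | exact S.zero_mem
    exact hle (Submodule.mul_mem_mul hx hy)
  rw [eq_top_iff]
  rintro x -
  obtain ⟨y, rfl⟩ := RingQuot.mkAlgHom_surjective k (ARel k) x
  induction y using FreeAlgebra.induction with
  | grade0 r =>
      rw [AlgHom.commutes, Algebra.algebraMap_eq_smul_one]
      exact S.smul_mem r hone
  | grade1 g => cases g with
    | e i => exact he i
    | ar a => exact ha a
  | mul a b hx hy => rw [map_mul]; exact hmul _ _ hx hy
  | add a b hx hy => rw [map_add]; exact S.add_mem hx hy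

lemma eq_sum_vertexIdem_add_sum_arrowElt (x : AlgA k) :
    x = ∑ i, simpleAlgHom k i x • vertexIdem k i + ∑ a, arrowCoeff k a x • arrowElt k a := by
  have hx : x ∈ Submodule.span k (Set.range (vertexIdem k) ∪ Set.range (arrowElt k)) := by
    rw [span_vertexIdem_arrowElt]
    exact Submodule.mem_top
  induction hx using Submodule.span_induction with
  | mem x h =>
      obtain ⟨i, rfl⟩ | ⟨a, rfl⟩ := h
      · simp [simpleAlgHom_vertexIdem, arrowCoeff_vertexIdem]
      · simp [simpleAlgHom_arrowElt, arrowCoeff_arrowElt]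
  | zero => simp
  | add x y _ _ hx hy =>
      simp only [map_add, add_smul, Finset.sum_add_distrib]
      nth_rewrite 1 [hx, hy]
      abel
  | smul c x _ hx =>
      simp only [map_smul, smul_assoc, ← Finset.smul_sum, ← smul_add]
      rw [← hx]

lemma arrowElt_mul (a : Fin 4) (x : AlgA k) :
    arrowElt k a * x = simpleAlgHom k (arrowTgt a) x • arrowElt k a := by
  conv_lhs => rw [eq_sum_vertexIdem_add_sum_arrowElt x]
  simp [mul_add, Finset.mul_sum, arrowElt_mul_vertexIdem, arrowElt_mul_arrowElt]

lemma mul_arrowElt (x : AlgA k) (a : Fin 4) :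
    x * arrowElt k a = simpleAlgHom k (arrowSrc a) x • arrowElt k a := by
  conv_lhs => rw [eq_sum_vertexIdem_add_sum_arrowElt x]
  simp [add_mul, Finset.sum_mul, vertexIdem_mul_arrowElt, arrowElt_mul_arrowElt]

lemma mul_vertexIdem (x : AlgA k) (i : Fin 3) :
    x * vertexIdem k i = simpleAlgHom k i x • vertexIdem k i +
      ∑ a, arrowCoeff k a x • (arrowElt k a * vertexIdem k i) := by
  conv_lhs => rw [eq_sum_vertexIdem_add_sum_arrowElt x]
  simp [add_mul, Finset.sum_mul, vertexIdem_mul_vertexIdem]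

end AlgebraStructure

section RightModules

variable {k : Type} [Field k]

variable (k) in
/-- The vertex idempotent, acting on right `A`-modules. -/
noncomputable def rightIdem (i : Fin 3) : Aop k := MulOpposite.op (vertexIdem k i)

variable (k) in
/-- The arrow `a`, acting on right `A`-modules. -/
noncomputable def rightArrow (a : Fin 4) : Aop k := MulOpposite.op (arrowElt k a)

lemma sum_rightIdem : ∑ i, rightIdem k i = 1 := by
  apply MulOpposite.unop_injective
  rw [Finset.unop_sum]
  exact sum_vertexIdem

lemma rightArrow_mul (a : Fin 4) (r : Aop k) :
    rightArrow k a * r = simpleAlgHom k (arrowSrc a) r.unop • rightArrow k a :=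
  MulOpposite.unop_injective (mul_arrowElt r.unop a)

lemma mul_rightArrow (r : Aop k) (a : Fin 4) :
    r * rightArrow k a = simpleAlgHom k (arrowTgt a) r.unop • rightArrow k a :=
  MulOpposite.unop_injective (arrowElt_mul a r.unop)

lemma rightIdem_arrowTgt_mul (a : Fin 4) :
    rightIdem k (arrowTgt a) * rightArrow k a = rightArrow k a :=
  MulOpposite.unop_injective (mul_vertexIdem_arrowTgt a)

lemma rightArrow_mul_rightArrow (a b : Fin 4) : rightArrow k a * rightArrow k b = 0 :=
  MulOpposite.unop_injective (arrowElt_mul_arrowElt b a)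

lemma rightIdem_mul (i : Fin 3) (r : Aop k) :
    rightIdem k i * r = simpleAlgHom k i r.unop • rightIdem k i +
      ∑ a, arrowCoeff k a r.unop • (rightIdem k i * rightArrow k a) := by
  apply MulOpposite.unop_injective
  simpa [rightIdem, rightArrow] using mul_vertexIdem r.unop i

lemma simpleS_smul_def (i : Fin 3) (r : Aop k) (s : SimpleS k i) :
    r • s = simpleAlgHom k i r.unop • s := rfl

instance (i : Fin 3) : IsScalarTower k (Aop k) (SimpleS k i) where
  smul_assoc c r s := by
    rw [simpleS_smul_def, simpleS_smul_def, MulOpposite.unop_smul, map_smul, smul_assoc]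

variable {P P' : Type*} [AddCommGroup P] [Module (Aop k) P] [Module k P]
  [IsScalarTower k (Aop k) P] [AddCommGroup P'] [Module (Aop k) P'] [Module k P']
  [IsScalarTower k (Aop k) P']

variable (k P) in
/-- The submodule `PJ` of a right `A`-module `P`, where `J` is the arrow ideal. -/
def radSub : Submodule (Aop k) P where
  carrier := {x | ∃ v : Fin 4 → P, ∑ a, rightArrow k a • v a = x}
  zero_mem' := ⟨0, by simp⟩
  add_mem' := by
    rintro _ _ ⟨v, rfl⟩ ⟨w, rfl⟩
    exact ⟨v + w, by simp [smul_add, Finset.sum_add_distrib]⟩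
  smul_mem' := by
    rintro r _ ⟨v, rfl⟩
    refine ⟨fun a => simpleAlgHom k (arrowTgt a) r.unop • v a, ?_⟩
    rw [Finset.smul_sum]
    refine Finset.sum_congr rfl fun a _ => ?_
    rw [← mul_smul, mul_rightArrow, smul_assoc, smul_comm]

lemma rightArrow_smul_mem_radSub (a : Fin 4) (x : P) : rightArrow k a • x ∈ radSub k P :=
  ⟨Pi.single a x, by
    rw [Finset.sum_eq_single a] <;> simp +contextual⟩

lemma rightArrow_smul_eq_zero_of_mem_radSub (a : Fin 4) {x : P} (hx : x ∈ radSub k P) :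
    rightArrow k a • x = 0 := by
  obtain ⟨v, rfl⟩ := hx
  simp [Finset.smul_sum, ← mul_smul, rightArrow_mul_rightArrow]

lemma radSub_le_ker_of_forall_rightArrow_smul {M : Type*} [AddCommGroup M] [Module (Aop k) M]
    (f : P →ₗ[Aop k] M) (h : ∀ a x, rightArrow k a • f x = 0) :
    radSub k P ≤ LinearMap.ker f := by
  rintro _ ⟨v, rfl⟩
  simp [h]

lemma rightIdem_smul_smul_sub_mem_radSub (i : Fin 3) (r : Aop k) (x : P) :
    rightIdem k i • r • x - simpleAlgHom k i r.unop • rightIdem k i • x ∈ radSub k P := by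
  rw [← mul_smul, rightIdem_mul, add_smul, smul_assoc, add_sub_cancel_left, Finset.sum_smul]
  refine sum_mem fun a _ => ?_
  rw [smul_assoc, mul_smul]
  exact Submodule.smul_of_tower_mem _ _
    (Submodule.smul_mem _ _ (rightArrow_smul_mem_radSub a x))

/-- In a projective module, the only relations between the images of the arrows are the
trivial ones modulo the radical. -/
lemma rightIdem_smul_mem_radSub_of_sum_eq_zero [Module.Projective (Aop k) P] {v : Fin 4 → P}
    (hv : ∑ a, rightArrow k a • v a = 0) (b : Fin 4) :
    rightIdem k (arrowSrc b) • v b ∈ radSub k P := by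
  obtain ⟨s, hs⟩ := Module.projective_def'.mp ‹Module.Projective (Aop k) P›
  have hcoeff (p : P) : simpleAlgHom k (arrowSrc b) (s (v b) p).unop = 0 := by
    have h := congrArg (fun x => arrowCoeff k b ((s x) p).unop) hv
    simpa [Finsupp.finsetSum_apply, rightArrow, mul_arrowElt, arrowCoeff_arrowElt] using h
  have hvb : v b = (s (v b)).sum fun p r => r • p := by
    conv_lhs => rw [← LinearMap.id_apply (R := Aop k) (v b), ← hs]
    rfl
  rw [hvb, Finsupp.sum, Finset.smul_sum]
  refine sum_mem fun p _ => ?_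
  simpa [hcoeff p] using rightIdem_smul_smul_sub_mem_radSub (arrowSrc b) (s (v b) p) p

lemma le_radSub_of_superfluous {N : Submodule (Aop k) P}
    (hN : ∀ K : Submodule (Aop k) P, K ⊔ N = ⊤ → K = ⊤) : N ≤ radSub k P := by
  intro n hn
  have key (i : Fin 3) : rightIdem k i • n ∈ radSub k P := by
    by_contra hni
    obtain ⟨f, hfn, hf⟩ := Submodule.exists_le_ker_of_notMem
      (p := (radSub k P).restrictScalars k) (v := rightIdem k i • n) hni
    have hsmul (r : Aop k) (x : P) :
        f (rightIdem k i • r • x) = simpleAlgHom k i r.unop * f (rightIdem k i • x) := by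
      have h : f _ = 0 := hf (rightIdem_smul_smul_sub_mem_radSub i r x)
      rwa [map_sub, f.map_smul, sub_eq_zero] at h
    let K : Submodule (Aop k) P :=
      { carrier := {x | f (rightIdem k i • x) = 0}
        zero_mem' := by simp
        add_mem' := fun {x y} (hx : f _ = 0) (hy : f _ = 0) => by
          simp [smul_add, hx, hy]
        smul_mem' := fun r x (hx : f _ = 0) => by simp [hsmul, hx] }
    have hK : K ⊔ N = ⊤ := by
      rw [eq_top_iff]
      rintro x -
      set c := f (rightIdem k i • x) / f (rightIdem k i • n)
      rw [← sub_add_cancel x (c • n)]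
      refine Submodule.add_mem_sup ?_ (Submodule.smul_of_tower_mem _ _ hn)
      change f _ = 0
      rw [smul_sub, map_sub, smul_comm, f.map_smul, smul_eq_mul, div_mul_cancel₀ _ hfn, sub_self]
    have hnK : n ∈ K := hN K hK ▸ Submodule.mem_top
    exact hfn hnK
  rw [← one_smul (Aop k) n, ← sum_rightIdem, Finset.sum_smul]
  exact sum_mem fun i _ => key i

lemma finite_of_ker_le_radSub {M : Type*} [AddCommGroup M] [Module k M] [Module.Finite k M]
    (f : P →ₗ[k] M) (hf : LinearMap.ker f ≤ (radSub k P).restrictScalars k) :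
    Module.Finite k P := by
  obtain ⟨W, hW⟩ := Submodule.exists_isCompl (LinearMap.ker f)
  have hinj : Function.Injective (f.domRestrict W) := by
    rw [← LinearMap.ker_eq_bot, LinearMap.ker_domRestrict, ← Submodule.disjoint_iff_comap_eq_bot]
    exact hW.symm.disjoint
  have hWfg : W.FG := Module.Finite.iff_fg.mp (Module.Finite.of_injective _ hinj)
  have hdecomp (x : P) : ∃ w ∈ W, x - w ∈ radSub k P := by
    obtain ⟨y, hy, w, hw, rfl⟩ := Submodule.mem_sup.mp
      (hW.sup_eq_top.symm ▸ Submodule.mem_top : x ∈ LinearMap.ker f ⊔ W)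
    exact ⟨w, hw, by simpa using hf hy⟩
  let X (a : Fin 4) : P →ₗ[k] P := Algebra.lsmul k k P (rightArrow k a)
  have hfg : (W ⊔ ⨆ a, W.map (X a)).FG := hWfg.sup (Submodule.fg_iSup _ fun a => hWfg.map _)
  suffices h : W ⊔ ⨆ a, W.map (X a) = ⊤ from ⟨h ▸ hfg⟩
  rw [eq_top_iff]
  rintro x -
  obtain ⟨w, hw, v, hv⟩ := hdecomp x
  rw [← add_sub_cancel w x, ← hv]
  refine Submodule.add_mem_sup hw (sum_mem fun a _ => ?_)
  obtain ⟨u, hu, hvu⟩ := hdecomp (v a)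
  have h := rightArrow_smul_eq_zero_of_mem_radSub a hvu
  rw [smul_sub, sub_eq_zero] at h
  exact Submodule.mem_iSup_of_mem a ⟨u, hu, h.symm⟩

/-- Families of elements of `P` at the sources of arrows ending at `j` that are independent
modulo the radical give rise to a family at the vertex `j` of the next term. -/
lemma exists_lift_of_range_eq_radSub [Module.Projective (Aop k) P] {W : Type*} [AddCommGroup W]
    [Module k W] (d : P' →ₗ[Aop k] P) (hd : LinearMap.range d = radSub k P) (j : Fin 3)
    (φ : Fin 4 → W →ₗ[k] P) (hj : ∀ a, arrowTgt a ≠ j → φ a = 0)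
    (hφ : ∀ w, (∀ a, rightIdem k (arrowSrc a) • φ a w ∈ radSub k P) → w = 0) :
    ∃ ψ : W →ₗ[k] P', ∀ w, rightIdem k j • ψ w ∈ radSub k P' → w = 0 := by
  let Φ : W →ₗ[k] P := ∑ a, (Algebra.lsmul k k P (rightArrow k a)).comp (φ a)
  have hΦ (w : W) : Φ w = ∑ a, rightArrow k a • φ a w := by simp [Φ]
  have hmem (w : W) : Φ w ∈ LinearMap.range (d.restrictScalars k) := by
    have h : Φ w ∈ LinearMap.range d := hd ▸ ⟨fun a => φ a w, (hΦ w).symm⟩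
    exact h
  obtain ⟨ψ, hψ⟩ := Module.projective_lifting_property (d.restrictScalars k).rangeRestrict
    (Φ.codRestrict _ hmem) (LinearMap.surjective_rangeRestrict _)
  have hdψ (w : W) : d (ψ w) = Φ w := congrArg Subtype.val (LinearMap.congr_fun hψ w)
  have hker : radSub k P' ≤ LinearMap.ker d :=
    radSub_le_ker_of_forall_rightArrow_smul d fun a x =>
      rightArrow_smul_eq_zero_of_mem_radSub a (hd ▸ LinearMap.mem_range_self d x)
  refine ⟨ψ, fun w hw => hφ w fun b => ?_⟩
  refine rightIdem_smul_mem_radSub_of_sum_eq_zero (v := fun a => φ a w) ?_ b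
  have h0 : d (rightIdem k j • ψ w) = 0 := hker hw
  rw [map_smul, hdψ, hΦ, Finset.smul_sum] at h0
  rw [← h0]
  refine Finset.sum_congr rfl fun a _ => ?_
  by_cases ha : arrowTgt a = j
  · rw [← ha, ← mul_smul, rightIdem_arrowTgt_mul]
  · simp [hj a ha]

end RightModules

section Resolution

variable {k : Type} [Field k] {P : ℕ → Type} [∀ n, AddCommGroup (P n)]
  [∀ n, Module (Aop k) (P n)] [∀ n, Module k (P n)] [∀ n, IsScalarTower k (Aop k) (P n)]
  {i : Fin 3} {ε : P 0 →ₗ[Aop k] SimpleS k i} {d : ∀ n, P (n + 1) →ₗ[Aop k] P n}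

lemma IsMinimalProjRes.ker_eq_radSub (h : IsMinimalProjRes k P ε d) :
    LinearMap.ker ε = radSub k (P 0) := by
  obtain ⟨-, -, -, -, hmin, -⟩ := h
  refine le_antisymm (le_radSub_of_superfluous hmin)
    (radSub_le_ker_of_forall_rightArrow_smul ε fun a x => ?_)
  rw [simpleS_smul_def]
  simp [rightArrow, simpleAlgHom_arrowElt]

lemma IsMinimalProjRes.range_eq_radSub (h : IsMinimalProjRes k P ε d) (n : ℕ) :
    LinearMap.range (d n) = radSub k (P n) := by
  have hker := h.ker_eq_radSub
  obtain ⟨-, -, hex₀, hex, -, hmin⟩ := h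
  induction n with
  | zero => rw [hex₀, hker]
  | succ n ih =>
      rw [hex]
      refine le_antisymm (le_radSub_of_superfluous (hmin n))
        (radSub_le_ker_of_forall_rightArrow_smul (d n) fun a x => ?_)
      exact rightArrow_smul_eq_zero_of_mem_radSub a (ih ▸ LinearMap.mem_range_self (d n) x)

lemma IsMinimalProjRes.finite (h : IsMinimalProjRes k P ε d) (n : ℕ) :
    Module.Finite k (P n) := by
  induction n with
  | zero =>
      have : Module.Finite k (SimpleS k i) := inferInstanceAs (Module.Finite k k)
      exact finite_of_ker_le_radSub (ε.restrictScalars k) fun x hx => h.ker_eq_radSub.le hx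
  | succ n ih =>
      refine finite_of_ker_le_radSub ((d n).restrictScalars k) fun x hx => ?_
      have hxd : x ∈ LinearMap.ker (d n) := hx
      rwa [← h.2.2.2.1 n, h.range_eq_radSub] at hxd

/-- A `2 ^ m`-dimensional space of elements at the vertex `2` in the term `P (2 * m)` of the
minimal projective resolution of `S₂`, independent modulo the radical. -/
lemma IsMinimalProjRes.exists_even {ε : P 0 →ₗ[Aop k] SimpleS k 1}
    (h : IsMinimalProjRes k P ε d) (m : ℕ) :
    ∃ (W : Type) (_ : AddCommGroup W) (_ : Module k W) (_ : Module.Finite k W)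
      (φ : W →ₗ[k] P (2 * m)), Module.finrank k W = 2 ^ m ∧
        ∀ w, rightIdem k 1 • φ w ∈ radSub k (P (2 * m)) → w = 0 := by
  have hproj := h.1
  induction m with
  | zero =>
      obtain ⟨u, hu⟩ := h.2.1 (1 : k)
      refine ⟨k, inferInstance, inferInstance, inferInstance, LinearMap.toSpanSingleton k _ u,
        by simp, fun c hc => ?_⟩
      have hc' : ε (rightIdem k 1 • c • u) = 0 := h.ker_eq_radSub.ge hc
      rw [map_smul, LinearMap.map_smul_of_tower, hu, simpleS_smul_def, rightIdem,
        MulOpposite.unop_op, simpleAlgHom_vertexIdem, if_pos rfl, one_smul] at hc'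
      exact (mul_one c).symm.trans hc'
  | succ m ih =>
      obtain ⟨W, _, _, _, φ, hW, hφ⟩ := ih
      obtain ⟨ψ₀, hψ₀⟩ := exists_lift_of_range_eq_radSub (d (2 * m)) (h.range_eq_radSub _) 0
        ![0, φ, 0, 0] (by simp [Fin.forall_fin_succ, arrowTgt])
        fun w hw => hφ w (hw 1)
      obtain ⟨ψ₂, hψ₂⟩ := exists_lift_of_range_eq_radSub (d (2 * m)) (h.range_eq_radSub _) 2
        ![0, 0, φ, 0] (by simp [Fin.forall_fin_succ, arrowTgt])
        fun w hw => hφ w (hw 2)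
      obtain ⟨θ, hθ⟩ := exists_lift_of_range_eq_radSub (d (2 * m + 1)) (h.range_eq_radSub _) 1
        ![ψ₀ ∘ₗ LinearMap.fst k W W, 0, 0, ψ₂ ∘ₗ LinearMap.snd k W W]
        (by simp [Fin.forall_fin_succ, arrowTgt])
        fun w hw => Prod.ext (hψ₀ _ (hw 0)) (hψ₂ _ (hw 3))
      exact ⟨W × W, inferInstance, inferInstance, inferInstance, θ,
        by rw [Module.finrank_prod, hW, pow_succ, mul_two], hθ⟩

end Resolution

/-- If `⋯ → P 1 → P 0 → S₂ → 0` is a minimal projective resolution of the simple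
`A`-module `S₂`, then `dim_k (P n) ≥ 2^(n/2)` for all `n ≥ 0`; in particular the
dimensions of the terms grow at least exponentially. -/
theorem dim_terms_of_minimal_resolution_ge (k : Type) [Field k]
    (P : ℕ → Type) [∀ n, AddCommGroup (P n)] [∀ n, Module (Aop k) (P n)]
    [∀ n, Module k (P n)] [∀ n, IsScalarTower k (Aop k) (P n)]
    (ε : P 0 →ₗ[Aop k] SimpleS k 1) (d : ∀ n, P (n + 1) →ₗ[Aop k] P n)
    (hres : IsMinimalProjRes k P ε d) :
    ∀ n : ℕ, 2 ^ (n / 2) ≤ Module.finrank k (P n) := by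
  intro n
  have hfin := hres.finite
  have hproj := hres.1
  have bound {W : Type} [AddCommGroup W] [Module k W] [Module.Finite k W] {n : ℕ} (j : Fin 3)
      (φ : W →ₗ[k] P n) (hφ : ∀ w, rightIdem k j • φ w ∈ radSub k (P n) → w = 0) :
      Module.finrank k W ≤ Module.finrank k (P n) := by
    refine LinearMap.finrank_le_finrank_of_injective (f := φ) ?_
    rw [injective_iff_map_eq_zero]
    exact fun w hw => hφ w (by simp [hw])
  obtain ⟨W, _, _, _, φ, hW, hφ⟩ := hres.exists_even (n / 2)
  rw [← hW]
  obtain hn | hn : 2 * (n / 2) = n ∨ 2 * (n / 2) + 1 = n := by omega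
  · exact (bound 1 φ hφ).trans_eq (by rw [hn])
  · obtain ⟨ψ, hψ⟩ := exists_lift_of_range_eq_radSub (d (2 * (n / 2))) (hres.range_eq_radSub _) 0
      ![0, φ, 0, 0] (by simp [Fin.forall_fin_succ, arrowTgt])
      fun w hw => hφ w (hw 1)
    exact (bound 0 ψ hψ).trans_eq (by rw [hn])
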